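/- arXiv:1611.04256 — 2 statements merged into one kernel-verified Lean document; each statement's English description precedes it below -/
import Mathlib

section
/- Let ∂₁ be a V×E matrix and ∂₂ an E×F matrix over 𝔽₂ with ∂₁∂₂ = 0, let S = {(∂₂a, ∂₁ᵀb)} be the CSS stabilizer subspace, let 𝓔 ⊆ E, let W'_𝓔 = {z ∈ 𝔽₂^E : zₑ = 0 for all e ∉ 𝓔}, and let W_𝓔 = W'_𝓔 × W'_𝓔. Then S^⊥ ∩ W_𝓔 ⊆ S if and only if both: (i) ker ∂₁ ∩ W'_𝓔 ⊆ im ∂₂ (every cycle covered by 𝓔 is a boundary), and (ii) ker ∂₂ᵀ ∩ W'_𝓔 ⊆ im ∂₁ᵀ (every cocycle covered by 𝓔 is a coboundary). That is, the erasure 𝓔 is correctable for the CSS code if and only if 𝓔 covers no homologically non-trivial cycle and no non-trivial cocycle. -/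
open Matrix

/-- The symplectic form on `𝔽₂^E × 𝔽₂^E`. -/
def symplForm {E : Type*} [Fintype E]
    (e f : (E → ZMod 2) × (E → ZMod 2)) : ZMod 2 :=
  (∑ i, e.1 i * f.2 i) + (∑ i, e.2 i * f.1 i)

/-- The CSS stabilizer subspace `S = {(∂₂a, ∂₁ᵀb)}`. -/
def CSSstab {V E F : Type*} [Fintype V] [Fintype E] [Fintype F]
    (d1 : Matrix V E (ZMod 2)) (d2 : Matrix E F (ZMod 2)) :
    Set ((E → ZMod 2) × (E → ZMod 2)) :=
  {p | ∃ (a : F → ZMod 2) (b : V → ZMod 2), p = (d2.mulVec a, d1.transpose.mulVec b)}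

/-- The vectors `z ∈ 𝔽₂^E` supported on the erasure `𝓔`, i.e. `W'_𝓔`. -/
def coveredVec {E : Type*} (𝓔 : Set E) (z : E → ZMod 2) : Prop :=
  ∀ e ∉ 𝓔, z e = 0

/-- the erasure `𝓔` is correctable for the CSS code
(`S^⊥ ∩ W_𝓔 ⊆ S`) iff every cycle covered by `𝓔` is a boundary and every cocycle covered
by `𝓔` is a coboundary. -/
theorem CSS_correctable_iff_homology {V E F : Type*} [Fintype V] [Fintype E] [Fintype F]
    (d1 : Matrix V E (ZMod 2)) (d2 : Matrix E F (ZMod 2)) (h : d1 * d2 = 0)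
    (𝓔 : Set E) :
    (∀ p : (E → ZMod 2) × (E → ZMod 2),
        (∀ s ∈ CSSstab d1 d2, symplForm p s = 0) →
        coveredVec 𝓔 p.1 → coveredVec 𝓔 p.2 → p ∈ CSSstab d1 d2)
    ↔ ((∀ z : E → ZMod 2, d1.mulVec z = 0 → coveredVec 𝓔 z →
          ∃ a : F → ZMod 2, z = d2.mulVec a) ∧
       (∀ x : E → ZMod 2, d2.transpose.mulVec x = 0 → coveredVec 𝓔 x →
          ∃ b : V → ZMod 2, x = d1.transpose.mulVec b)) := by
  have key : ∀ (p : (E → ZMod 2) × (E → ZMod 2)) (a : F → ZMod 2) (b : V → ZMod 2),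
      symplForm p (d2.mulVec a, d1.transpose.mulVec b)
        = (d1.mulVec p.1) ⬝ᵥ b + (d2.transpose.mulVec p.2) ⬝ᵥ a := by
    intro p a b
    have h1 : p.1 ⬝ᵥ (d1.transpose.mulVec b) = (d1.mulVec p.1) ⬝ᵥ b := by
      rw [Matrix.dotProduct_mulVec, Matrix.vecMul_transpose]
    have h2 : p.2 ⬝ᵥ (d2.mulVec a) = (d2.transpose.mulVec p.2) ⬝ᵥ a := by
      rw [Matrix.dotProduct_mulVec, Matrix.mulVec_transpose]
    rw [← h1, ← h2]
    rfl
  have perp : ∀ p : (E → ZMod 2) × (E → ZMod 2),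
      (∀ s ∈ CSSstab d1 d2, symplForm p s = 0) ↔
        (d1.mulVec p.1 = 0 ∧ d2.transpose.mulVec p.2 = 0) := by
    intro p
    constructor
    · intro hp
      constructor
      · apply dotProduct_eq_zero
        intro b
        have := hp _ ⟨0, b, rfl⟩
        rw [key] at this
        simpa using this
      · apply dotProduct_eq_zero
        intro a
        have := hp _ ⟨a, 0, rfl⟩
        rw [key] at this
        simpa using this
    · rintro ⟨h1, h2⟩ s ⟨a, b, rfl⟩
      rw [key, h1, h2]
      simp
  constructor
  · intro H
    constructor
    · intro z hz hc
      obtain ⟨a, b, hab⟩ := H (z, 0) ((perp _).2 ⟨hz, by simp⟩) hc (fun _ _ => rfl)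
      exact ⟨a, congrArg Prod.fst hab⟩
    · intro x hx hc
      obtain ⟨a, b, hab⟩ := H (0, x) ((perp _).2 ⟨by simp, hx⟩) (fun _ _ => rfl) hc
      exact ⟨b, congrArg Prod.snd hab⟩
  · rintro ⟨H1, H2⟩ p hp hc1 hc2
    obtain ⟨h1, h2⟩ := (perp p).1 hp
    obtain ⟨a, ha⟩ := H1 _ h1 hc1
    obtain ⟨b, hb⟩ := H2 _ h2 hc2
    exact ⟨a, b, Prod.ext ha hb⟩
end

section
/- Let ∂₁ be a V×E matrix and ∂₂ an E×F matrix over 𝔽₂ with ∂₁∂₂ = 0, let S = {(∂₂a, ∂₁ᵀb)} be the CSS stabilizer subspace, let 𝓔 ⊆ E, W'_𝓔 = {z ∈ 𝔽₂^E : zₑ = 0 for all e ∉ 𝓔}, and W_𝓔 = W'_𝓔 × W'_𝓔. Then the erasure 𝓔 is correctable (S^⊥ ∩ W_𝓔 ⊆ S) if and only if dim(ker ∂₁ ∩ W'_𝓔) + dim(ker ∂₂ᵀ ∩ W'_𝓔) = dim(im ∂₂ ∩ W'_𝓔) + dim(im ∂₁ᵀ ∩ W'_𝓔); equivalently, if and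 only if h₁(𝓔) + h₁*(𝓔) = 0, where h₁(𝓔) = dim(ker ∂₁ ∩ W'_𝓔) − dim(im ∂₂ ∩ W'_𝓔) and h₁*(𝓔) = dim(ker ∂₂ᵀ ∩ W'_𝓔) − dim(im ∂₁ᵀ ∩ W'_𝓔) are the dimensions of the first homology and cohomology groups covered by 𝓔. -/
open Matrix

/-- The subspace `W'_𝓔 ≤ 𝔽₂^E` of vectors supported on the erasure `𝓔`. -/
def coveredSub {E : Type*} (𝓔 : Set E) : Submodule (ZMod 2) (E → ZMod 2) where
  carrier := {z | ∀ e ∉ 𝓔, z e = 0}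
  add_mem' := by intro z w hz hw e he; simp [hz e he, hw e he]
  zero_mem' := by intro e _; rfl
  smul_mem' := by intro c z hz e he; simp [hz e he]

theorem perp_iff {V E F : Type*}
    [Fintype V] [Fintype E] [Fintype F]
    (d1 : Matrix V E (ZMod 2)) (d2 : Matrix E F (ZMod 2))
    (p : (E → ZMod 2) × (E → ZMod 2)) :
    (∀ s ∈ CSSstab d1 d2, symplForm p s = 0) ↔
      d1.mulVec p.1 = 0 ∧ d2.transpose.mulVec p.2 = 0 := by
  have key : ∀ a b, symplForm p (d2.mulVec a, d1.transpose.mulVec b) =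
      d1.mulVec p.1 ⬝ᵥ b + d2.transpose.mulVec p.2 ⬝ᵥ a := by
    intro a b
    change p.1 ⬝ᵥ d1.transpose.mulVec b + p.2 ⬝ᵥ d2.mulVec a = _
    rw [Matrix.dotProduct_mulVec, Matrix.dotProduct_mulVec, Matrix.vecMul_transpose,
      Matrix.mulVec_transpose]
  constructor
  · intro hs
    constructor
    · refine dotProduct_eq_zero _ fun b => ?_
      have := hs _ ⟨0, b, rfl⟩
      rw [key] at this
      simpa using this
    · refine dotProduct_eq_zero _ fun a => ?_
      have := hs _ ⟨a, 0, rfl⟩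
      rw [key] at this
      simpa using this
  · rintro ⟨h1, h2⟩ s ⟨a, b, rfl⟩
    rw [key, h1, h2]
    simp

/-- the erasure `𝓔` is correctable for the CSS code (`S^⊥ ∩ W_𝓔 ⊆ S`) iff
`dim(ker ∂₁ ∩ W'_𝓔) + dim(ker ∂₂ᵀ ∩ W'_𝓔) = dim(im ∂₂ ∩ W'_𝓔) + dim(im ∂₁ᵀ ∩ W'_𝓔)`,
i.e. iff `h₁(𝓔) + h₁*(𝓔) = 0`. -/
theorem CSS_correctable_iff_homology_dims {V E F : Type*}
    [Fintype V] [Fintype E] [Fintype F]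
    (d1 : Matrix V E (ZMod 2)) (d2 : Matrix E F (ZMod 2)) (h : d1 * d2 = 0)
    (𝓔 : Set E) :
    (∀ p : (E → ZMod 2) × (E → ZMod 2),
        (∀ s ∈ CSSstab d1 d2, symplForm p s = 0) →
        p.1 ∈ coveredSub 𝓔 → p.2 ∈ coveredSub 𝓔 → p ∈ CSSstab d1 d2)
    ↔ (Module.finrank (ZMod 2) ↥(LinearMap.ker d1.mulVecLin ⊓ coveredSub 𝓔)
        + Module.finrank (ZMod 2) ↥(LinearMap.ker d2.transpose.mulVecLin ⊓ coveredSub 𝓔)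
      = Module.finrank (ZMod 2) ↥(LinearMap.range d2.mulVecLin ⊓ coveredSub 𝓔)
        + Module.finrank (ZMod 2) ↥(LinearMap.range d1.transpose.mulVecLin ⊓ coveredSub 𝓔)) := by
  have hT : d2.transpose * d1.transpose = 0 := by
    rw [← Matrix.transpose_mul, h, Matrix.transpose_zero]
  have le1 : LinearMap.range d2.mulVecLin ⊓ coveredSub 𝓔 ≤
      LinearMap.ker d1.mulVecLin ⊓ coveredSub 𝓔 := by
    refine inf_le_inf_right _ ?_
    rintro _ ⟨a, rfl⟩
    simp [h]
  have le2 : LinearMap.range d1.transpose.mulVecLin ⊓ coveredSub 𝓔 ≤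
      LinearMap.ker d2.transpose.mulVecLin ⊓ coveredSub 𝓔 := by
    refine inf_le_inf_right _ ?_
    rintro _ ⟨a, rfl⟩
    simp only [LinearMap.mem_ker, Matrix.mulVecLin_apply, Matrix.mulVec_mulVec, hT,
      Matrix.zero_mulVec]
  constructor
  · intro H
    have e1 : LinearMap.range d2.mulVecLin ⊓ coveredSub 𝓔 =
        LinearMap.ker d1.mulVecLin ⊓ coveredSub 𝓔 := by
      refine le_antisymm le1 ?_
      rintro z ⟨hz, hz'⟩
      obtain ⟨a, b, hab⟩ := H (z, 0)
        ((perp_iff d1 d2 _).2 ⟨by simpa using hz, by simp⟩) hz' (Submodule.zero_mem _)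
      exact ⟨⟨a, (congrArg Prod.fst hab).symm⟩, hz'⟩
    have e2 : LinearMap.range d1.transpose.mulVecLin ⊓ coveredSub 𝓔 =
        LinearMap.ker d2.transpose.mulVecLin ⊓ coveredSub 𝓔 := by
      refine le_antisymm le2 ?_
      rintro z ⟨hz, hz'⟩
      obtain ⟨a, b, hab⟩ := H (0, z)
        ((perp_iff d1 d2 _).2 ⟨by simp, hz⟩) (Submodule.zero_mem _) hz'
      exact ⟨⟨b, (congrArg Prod.snd hab).symm⟩, hz'⟩
    rw [e1, e2]
  · intro H p hp hp1 hp2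
    have f1 := Submodule.finrank_mono le1
    have f2 := Submodule.finrank_mono le2
    have e1 := Submodule.eq_of_le_of_finrank_eq le1 (by omega)
    have e2 := Submodule.eq_of_le_of_finrank_eq le2 (by omega)
    obtain ⟨h1, h2⟩ := (perp_iff d1 d2 p).1 hp
    have m1 : p.1 ∈ LinearMap.ker d1.mulVecLin ⊓ coveredSub 𝓔 := ⟨h1, hp1⟩
    have m2 : p.2 ∈ LinearMap.ker d2.transpose.mulVecLin ⊓ coveredSub 𝓔 := ⟨h2, hp2⟩
    rw [← e1] at m1
    rw [← e2] at m2
    obtain ⟨⟨a, ha⟩, -⟩ := m1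
    obtain ⟨⟨b, hb⟩, -⟩ := m2
    exact ⟨a, b, Prod.ext ha.symm hb.symm⟩
end
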